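/- arXiv:math/0505275 — 2 statements merged into one kernel-verified Lean document; each statement's English description precedes it below -/
import Mathlib

section
/- Let k be an algebraically closed field of characteristic p > 0 and let D = d/dt denote the formal derivative on the field k((t)) of formal Laurent series. For z ∈ k((t)), there exists a nonzero u ∈ k((t)) with z = D(u)/u (i.e. the differential form z dt is logarithmic) if and only if D^{p-1}(z) = -z^{p}. -/
open HahnSeries

/-- The formal derivative `d/dt` on the field `k((t))` of formal Laurent series,
acting coefficientwise by `D (∑ aₙ tⁿ) = ∑ n aₙ t^(n-1)`. -/
noncomputable def laurentDeriv {k : Type*} [Field k] (f : LaurentSeries k) :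
    LaurentSeries k where
  coeff n := ((n + 1 : ℤ) : k) * f.coeff (n + 1)
  isPWO_support' := by
    refine Set.IsPWO.mono
      (f.isPWO_support'.image_of_monotone (f := fun m : ℤ => m - 1)
        (fun a b h => by simpa using h)) ?_
    intro n hn
    have hne : f.coeff (n + 1) ≠ 0 := by
      intro h
      simp [Function.mem_support, h] at hn
    exact ⟨n + 1, hne, by ring⟩

section Jac
open Polynomial

theorem jac_deriv {A : Type*} [Ring A] (d : A) (w : ℕ → A)
    (hd : ∀ n, d * w n = w n * d + w (n + 1)) (hw : ∀ n, w 0 * w n = w n * w 0) (n : ℕ) :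
    derivative ((Polynomial.C d + Polynomial.C (w 0) * X) ^ n) =
      ∑ i ∈ Finset.range n, (n.choose (i + 1)) •
        (Polynomial.C (w i) * (Polynomial.C d + Polynomial.C (w 0) * X) ^ (n - 1 - i)) := by
  set T : A[X] := Polynomial.C d + Polynomial.C (w 0) * X with hT
  have hTW : ∀ i, T * Polynomial.C (w i) = Polynomial.C (w i) * T + Polynomial.C (w (i + 1)) := by
    intro i
    have h1 : Polynomial.C (w 0) * X * Polynomial.C (w i) = Polynomial.C (w i) * (Polynomial.C (w 0) * X) := by
      rw [mul_assoc, X_mul_C, ← mul_assoc, ← mul_assoc, ← C_mul, ← C_mul, hw]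
    rw [hT, add_mul, mul_add, h1, ← C_mul, hd, C_add, C_mul]
    abel
  have hTd : derivative T = Polynomial.C (w 0) := by
    rw [hT, derivative_add, derivative_C, derivative_C_mul_X, zero_add]
  induction n with
  | zero => simp
  | succ n ih =>
    rw [pow_succ', derivative_mul, hTd, ih, Finset.mul_sum]
    have h2 : ∀ i ∈ Finset.range n, T * (n.choose (i + 1) • (Polynomial.C (w i) * T ^ (n - 1 - i))) =
        n.choose (i + 1) • (Polynomial.C (w i) * T ^ (n - i)) +
        n.choose (i + 1) • (Polynomial.C (w (i + 1)) * T ^ (n - (i + 1))) := by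
      intro i hi
      have hi' := Finset.mem_range.1 hi
      rw [mul_smul_comm, ← mul_assoc, hTW, add_mul, mul_assoc, ← pow_succ', smul_add,
        show n - 1 - i + 1 = n - i by omega, show n - 1 - i = n - (i + 1) by omega]
    rw [Finset.sum_congr rfl h2, Finset.sum_add_distrib]
    have h3 : Polynomial.C (w 0) * T ^ n + ∑ i ∈ Finset.range n,
        n.choose (i + 1) • (Polynomial.C (w (i + 1)) * T ^ (n - (i + 1))) =
        ∑ i ∈ Finset.range (n + 1), n.choose i • (Polynomial.C (w i) * T ^ (n - i)) := by
      rw [Finset.sum_range_succ']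
      simp [add_comm]
    have h4 : ∑ i ∈ Finset.range n, n.choose (i + 1) • (Polynomial.C (w i) * T ^ (n - i)) =
        ∑ i ∈ Finset.range (n + 1), n.choose (i + 1) • (Polynomial.C (w i) * T ^ (n - i)) := by
      rw [Finset.sum_range_succ]
      simp
    rw [add_left_comm, h3, h4, ← Finset.sum_add_distrib]
    refine Finset.sum_congr rfl fun i _ => ?_
    rw [← add_smul, Nat.choose_succ_succ, Nat.add_sub_cancel, add_comm]

theorem jac {A : Type*} [Ring A] (p : ℕ) (hp : p.Prime) (hp0 : (p : A) = 0)
    (hu : ∀ n : ℕ, ¬ p ∣ n → IsUnit (n : A)) (d : A) (w : ℕ → A)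
    (hd : ∀ n, d * w n = w n * d + w (n + 1)) (hw : ∀ n, w 0 * w n = w n * w 0) :
    (d + w 0) ^ p = d ^ p + w (p - 1) + w 0 ^ p := by
  have hp2 := hp.two_le
  have h1 : derivative ((Polynomial.C d + Polynomial.C (w 0) * X) ^ p) = Polynomial.C (w (p - 1)) := by
    rw [jac_deriv d w hd hw, Finset.sum_eq_single (p - 1)]
    · simp [Nat.sub_add_cancel hp.one_le]
    · intro i hi hne
      have hi' := Finset.mem_range.1 hi
      obtain ⟨c, hc⟩ := hp.dvd_choose_self (k := i + 1) (by omega) (by omega)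
      rw [hc, ← Nat.cast_smul_eq_nsmul A, Nat.cast_mul, hp0, zero_mul, zero_smul]
    · intro h
      exact absurd (Finset.mem_range.2 (by omega)) h
  have hdeg : (Polynomial.C d + Polynomial.C (w 0) * X : A[X]).natDegree ≤ 1 := by
    rw [add_comm]; exact natDegree_linear_le
  have h2 : (Polynomial.C d + Polynomial.C (w 0) * X : A[X]) ^ p =
      Polynomial.C (d ^ p) + Polynomial.C (w (p - 1)) * X + Polynomial.C (w 0 ^ p) * X ^ p := by
    ext n
    rcases Nat.eq_zero_or_pos n with rfl | hn
    · have : ∀ m : ℕ, ((Polynomial.C d + Polynomial.C (w 0) * X : A[X]) ^ m).coeff 0 = d ^ m := by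
        intro m
        induction m with
        | zero => simp
        | succ m ih => rw [pow_succ, mul_coeff_zero, ih, pow_succ]; simp
      rw [this]
      simp [-map_pow, coeff_X_pow, hp.ne_zero.symm, hp.ne_zero]
    · by_cases hnp : p ∣ n
      · rcases (Nat.le_of_dvd hn hnp).eq_or_lt with h | h
        · subst h
          have := coeff_pow_of_natDegree_le (m := p) hdeg
          rw [mul_one] at this
          rw [this]
          simp [-map_pow, coeff_X, coeff_C, hp.ne_zero, hp.one_lt.ne]
        · rw [coeff_eq_zero_of_natDegree_lt]
          · simp [-map_pow, coeff_X, coeff_C, coeff_X_pow, hn.ne', h.ne', show (1 : ℕ) ≠ n by omega]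
          · have := natDegree_pow_le_of_le p hdeg
            omega
      · obtain ⟨m, rfl⟩ : ∃ m, n = m + 1 := ⟨n - 1, by omega⟩
        have h3 := congrArg (fun q => Polynomial.coeff q m) h1
        simp only [coeff_derivative] at h3
        have hne : m + 1 ≠ p := fun h => hnp (h ▸ dvd_rfl)
        have hU := hu _ hnp
        push_cast at hU
        apply hU.mul_right_cancel
        rw [h3]
        rcases Nat.eq_zero_or_pos m with rfl | hm
        · simp [-map_pow, coeff_X, coeff_C, coeff_X_pow, hp.one_lt.ne]
        · simp [-map_pow, coeff_X, coeff_C, coeff_X_pow, hm.ne, hm.ne', hne]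
  have h3 := congrArg (eval₂RingHom' (RingHom.id A) (1 : A) (fun a => Commute.one_right _)) h2
  rw [map_pow] at h3
  simpa [-map_pow, eval₂RingHom'] using h3

end Jac

theorem laurentDeriv_eq {k : Type*} [Field k] (f : LaurentSeries k) :
    laurentDeriv f = LaurentSeries.derivative k f := by
  ext n
  simp [laurentDeriv]

theorem laurentDeriv_mul {k : Type*} [Field k] (f g : LaurentSeries k) :
    laurentDeriv (f * g) = laurentDeriv f * g + f * laurentDeriv g := by
  let E : LaurentSeries k → LaurentSeries k := fun f => single 1 1 * laurentDeriv f
  have hE : ∀ f n, (E f).coeff n = (n : k) * f.coeff n := by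
    intro f n
    have := coeff_single_mul_add (r := (1 : k)) (x := laurentDeriv f) (a := n - 1) (b := 1)
    rw [sub_add_cancel] at this
    simp only [E]
    rw [this]
    simp [laurentDeriv]
  have hs : ∀ f, (E f).support ⊆ f.support := by
    intro f n hn h
    apply hn
    rw [hE, show f.coeff n = 0 from h, mul_zero]
  have key : E (f * g) = E f * g + f * E g := by
    ext n
    rw [hE, coeff_add, coeff_mul (x := f) (y := g), coeff_mul_left' f.isPWO_support (hs f),
      coeff_mul_right' g.isPWO_support (hs g), ← Finset.sum_add_distrib,
      Finset.mul_sum]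
    refine Finset.sum_congr rfl fun ij hij => ?_
    have := (Finset.mem_antidiagonal.1 hij).2.2
    rw [hE, hE, ← this]
    push_cast
    ring
  have h1 : (single 1 1 : LaurentSeries k) ≠ 0 := by simp
  apply mul_left_cancel₀ h1
  simp only [E] at key
  rw [key]
  ring

noncomputable def mulEnd {k : Type*} [Field k] (z : LaurentSeries k) :
    Module.End k (LaurentSeries k) where
  toFun f := z * f
  map_add' := mul_add z
  map_smul' r f := by
    simp only [← HahnSeries.C_mul_eq_smul, RingHom.id_apply]
    ring

theorem mulEnd_apply {k : Type*} [Field k] (z f : LaurentSeries k) : mulEnd z f = z * f := rfl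

theorem mulEnd_pow {k : Type*} [Field k] (z : LaurentSeries k) (n : ℕ) :
    mulEnd z ^ n = mulEnd (z ^ n) := by
  induction n with
  | zero => refine LinearMap.ext fun f => ?_; simp [mulEnd_apply]
  | succ n ih =>
    refine LinearMap.ext fun f => ?_
    rw [pow_succ, ih, Module.End.mul_apply, mulEnd_apply, mulEnd_apply, mulEnd_apply, pow_succ,
      mul_assoc]

theorem key_formula {k : Type*} [Field k] (p : ℕ) [CharP k p] (hp : p.Prime)
    (z f : LaurentSeries k) :
    ((LaurentSeries.derivative k + mulEnd (-z)) ^ p : Module.End k (LaurentSeries k)) f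
      = -(laurentDeriv^[p - 1] z + z ^ p) * f := by
  have hD : (laurentDeriv : LaurentSeries k → LaurentSeries k) = LaurentSeries.derivative k :=
    funext laurentDeriv_eq
  let D : Module.End k (LaurentSeries k) := LaurentSeries.derivative k
  have hc : ∀ n : ℕ, (n : Module.End k (LaurentSeries k)) = algebraMap k _ (n : k) := by
    intro n; simp
  have h := jac (A := Module.End k (LaurentSeries k)) p hp (by rw [hc]; simp)
    (fun n hn => by
      rw [hc]
      exact (IsUnit.mk0 _ (fun h => hn ((CharP.cast_eq_zero_iff k p n).1 h))).map _)
    D (fun n => mulEnd ((D ^ n) (-z)))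
    (fun n => by
      refine LinearMap.ext fun g => ?_
      have := laurentDeriv_mul ((D ^ n) (-z)) g
      rw [hD] at this
      change D _ = _ * D g + (D ^ (n + 1)) (-z) * g
      rw [pow_succ']
      exact this.trans (add_comm _ _))
    (fun n => by
      refine LinearMap.ext fun g => ?_
      exact mul_left_comm _ _ _)
  simp only [pow_zero] at h
  have hDp : D ^ p = 0 := by
    refine LinearMap.ext fun g => ?_
    rw [Module.End.pow_apply]
    change (LaurentSeries.derivative k)^[p] g = 0
    rw [LaurentSeries.derivative_iterate, ← Nat.cast_smul_eq_nsmul k,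
      (CharP.cast_eq_zero_iff k p _).2 (Nat.dvd_factorial hp.pos le_rfl), zero_smul]
  rw [hDp, zero_add] at h
  have h' := LinearMap.congr_fun h f
  refine h'.trans ?_
  have : Fact p.Prime := ⟨hp⟩
  have : CharP (LaurentSeries k) p :=
    charP_of_injective_algebraMap (algebraMap k (LaurentSeries k)).injective p
  have hz : (-z) ^ p = -z ^ p := by
    have := sub_pow_char (p := p) (0 : LaurentSeries k) z
    simpa [hp.ne_zero] using this
  have h5 : (mulEnd (-z)) ^ p = mulEnd ((-z) ^ p) :=
    mulEnd_pow _ p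
  change (D ^ (p - 1)) (-z) * f + ((mulEnd (-z)) ^ p : Module.End k (LaurentSeries k)) f = _
  rw [h5, hz, hD, map_neg, Module.End.pow_apply, mulEnd_apply]
  change -((LaurentSeries.derivative k)^[p - 1] z) * f + _ = _
  ring

/-- Let `k` be an algebraically closed field of characteristic `p > 0` and
let `D = d/dt` be the formal derivative on `k((t))`.  For `z ∈ k((t))`, there exists a
nonzero `u ∈ k((t))` with `z = D(u)/u` (i.e. `z dt` is logarithmic) if and only if
`D^[p-1] z = -z^p`. -/
theorem stmt1 {k : Type*} [Field k] [IsAlgClosed k] (p : ℕ) [CharP k p] (hp : 0 < p)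
    (z : LaurentSeries k) :
    (∃ u : LaurentSeries k, u ≠ 0 ∧ z = laurentDeriv u / u) ↔
      laurentDeriv^[p - 1] z = -z ^ p := by
  have hpp : p.Prime := (CharP.char_is_prime_or_zero k p).resolve_right hp.ne'
  have key := key_formula p hpp z
  set L : Module.End k (LaurentSeries k) :=
    LaurentSeries.derivative k + mulEnd (-z) with hL
  have hLa : ∀ u, L u = laurentDeriv u - z * u := by
    intro u
    rw [laurentDeriv_eq, hL, LinearMap.add_apply, mulEnd_apply]
    ring
  constructor
  · rintro ⟨u, hu, hz⟩
    have h0 : L u = 0 := by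
      rw [hLa, hz, div_mul_cancel₀ _ hu, sub_self]
    have h1 := key u
    rw [← Nat.sub_add_cancel hpp.one_le, pow_succ, Module.End.mul_apply, h0, map_zero,
      Nat.sub_add_cancel hpp.one_le] at h1
    have h2 := (mul_eq_zero.1 h1.symm).resolve_right hu
    exact eq_neg_of_add_eq_zero_left (neg_eq_zero.1 h2)
  · intro h
    have h0 : L ^ p = 0 := by
      refine LinearMap.ext fun f => ?_
      rw [key, h]
      simp
    by_contra hcon
    have hinj : Function.Injective L := by
      rw [injective_iff_map_eq_zero]
      intro u hu
      by_contra hne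
      refine hcon ⟨u, hne, ?_⟩
      rw [hLa, sub_eq_zero] at hu
      rw [hu, mul_div_cancel_right₀ _ hne]
    have h2 : Function.Injective (L ^ p : Module.End k (LaurentSeries k)) := by
      rw [Module.End.coe_pow]
      exact hinj.iterate p
    rw [h0] at h2
    exact one_ne_zero (h2 (a₁ := (1 : LaurentSeries k)) (a₂ := 0) rfl)
end

section
/- Let p be an odd prime, k an algebraically closed field of characteristic p, λ ∈ k with λ ≠ 0 and λ ≠ 1, and β ∈ k. Let L be the operator L(u) = t(t-1)(t-λ)·u'' + (3t² - 2(1+λ)t + λ)·u' + (t - β)·u on k[t]. If there exists a nonzero polynomial u ∈ k[t] with L(u) = 0, then there exists exactly one monic polynomial u ∈ k[t] of degree p - 1 with L(u) = 0. -/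
open Polynomial

/-- The operator `L(u) = t(t-1)(t-λ) u'' + (3t² - 2(1+λ)t + λ) u' + (t - β) u`
on the polynomial ring `k[t]`. -/
noncomputable def Lop {k : Type*} [Field k] (l b : k) (u : Polynomial k) : Polynomial k :=
  X * (X - 1) * (X - C l) * derivative (derivative u)
    + (3 * X ^ 2 - Polynomial.C (2 * (1 + l)) * X + C l) * derivative u
    + (X - C b) * u


lemma Lop_coeff {k : Type*} [Field k] (l b : k) (u : Polynomial k) (m : ℕ) :
    (Lop l b u).coeff m = (m : k) ^ 2 * u.coeff (m - 1)
      - ((1 + l) * m * (m + 1) + b) * u.coeff m + l * ((m : k) + 1) ^ 2 * u.coeff (m + 1) := by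
  have h : Lop l b u = X * (X * (X * derivative (derivative u)))
      - C (1 + l) * (X * (X * derivative (derivative u)))
      + C l * (X * derivative (derivative u))
      + C 3 * (X * (X * derivative u)) - C (2 * (1 + l)) * (X * derivative u)
      + C l * derivative u + X * u - C b * u := by
    unfold Lop
    simp only [map_add, map_one, map_mul, map_ofNat]
    ring
  rw [h]
  rcases m with _ | _ | _ | n <;>
    simp only [coeff_add, coeff_sub, coeff_C_mul, coeff_X_mul, coeff_X_mul_zero,
      coeff_derivative, zero_add, Nat.add_sub_cancel] <;> push_cast <;> ring

lemma Lop_deg {k : Type*} [Field k] (p : ℕ) (hp : p.Prime) [CharP k p] (l b : k)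
    (u : Polynomial k) (h0 : u ≠ 0) (hu : Lop l b u = 0) (hd : u.natDegree < p) :
    u.natDegree = p - 1 := by
  have h := Lop_coeff l b u (u.natDegree + 1)
  rw [hu, coeff_eq_zero_of_natDegree_lt (p := u) (n := u.natDegree + 1) (by omega),
    coeff_eq_zero_of_natDegree_lt (p := u) (n := u.natDegree + 1 + 1) (by omega)] at h
  simp only [coeff_zero, mul_zero, sub_zero, add_zero, Nat.add_sub_cancel, coeff_natDegree] at h
  have h1 : ((u.natDegree + 1 : ℕ) : k) = 0 := by
    rcases mul_eq_zero.1 h.symm with h | h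
    · exact pow_eq_zero_iff (two_ne_zero) |>.1 h
    · exact absurd (leadingCoeff_eq_zero.1 h) h0
  have := Nat.le_of_dvd (by omega) ((CharP.cast_eq_zero_iff k p _).1 h1)
  omega

/-- Let `p` be an odd prime, `k` algebraically closed of characteristic
`p`, `λ ∈ k \ {0,1}`, `β ∈ k`.  If there exists a nonzero polynomial `u ∈ k[t]` with
`L(u) = 0`, then there exists exactly one monic polynomial `u` of degree `p - 1` with
`L(u) = 0`. -/
theorem stmt7 {k : Type*} [Field k] [IsAlgClosed k] (p : ℕ) (hp : p.Prime) (hodd : Odd p)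
    [CharP k p] (l b : k) (hl0 : l ≠ 0) (hl1 : l ≠ 1)
    (hex : ∃ u : Polynomial k, u ≠ 0 ∧ Lop l b u = 0) :
    ∃! u : Polynomial k, u.Monic ∧ u.natDegree = p - 1 ∧ Lop l b u = 0 := by
  have hp1 := hp.two_le
  have hpk : (p : k) = 0 := CharP.cast_eq_zero k p
  obtain ⟨u, hu0, hu⟩ := hex
  set j := u.natDegree / p with hj
  let v : Polynomial k := ∑ i ∈ Finset.range p, monomial i (u.coeff (p * j + i))
  have hv : ∀ m, v.coeff m = if m < p then u.coeff (p * j + m) else 0 := by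
    intro m
    simp [v, finsetSum_coeff, coeff_monomial]
  have hv0 : v ≠ 0 := by
    intro h
    have h2 := hv (u.natDegree % p)
    rw [h, if_pos (Nat.mod_lt _ (by omega)), hj, Nat.div_add_mod] at h2
    exact hu0 (leadingCoeff_eq_zero.1 (by simpa using h2.symm))
  have hvd : v.natDegree < p := by
    by_contra h
    have h2 := hv v.natDegree
    rw [if_neg h] at h2
    exact hv0 (leadingCoeff_eq_zero.1 h2)
  have hvL : Lop l b v = 0 := by
    ext m
    rw [Lop_coeff, hv, hv, hv, coeff_zero]
    have h := Lop_coeff l b u (p * j + m)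
    rw [hu, coeff_zero] at h
    push_cast at h
    rw [hpk] at h
    simp only [zero_mul, zero_add] at h
    by_cases hm : m < p
    · rw [if_pos hm, if_pos (show m - 1 < p by omega)]
      have e1 : (m : k) ^ 2 * u.coeff (p * j + (m - 1)) = (m : k) ^ 2 * u.coeff (p * j + m - 1) := by
        rcases m with _ | m
        · simp
        · rfl
      rw [e1]
      by_cases hm1 : m + 1 < p
      · rw [if_pos hm1, ← add_assoc]; exact h.symm
      · have : (m : k) + 1 = 0 := by
          have : m + 1 = p := by omega
          rw [← hpk, ← this]; push_cast; rfl
        rw [this] at h ⊢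
        rw [if_neg hm1]
        simpa using h.symm
    · rw [if_neg hm, if_neg (show ¬ m + 1 < p by omega)]
      by_cases hm1 : m - 1 < p
      · have : m = p := by omega
        rw [this, hpk]; simp
      · rw [if_neg hm1]; simp
  have hvdeg := Lop_deg p hp l b v hv0 hvL hvd
  have hlc : v.leadingCoeff ≠ 0 := leadingCoeff_ne_zero.2 hv0
  refine ⟨C v.leadingCoeff⁻¹ * v, ⟨?_, ?_, ?_⟩, ?_⟩
  · rw [Monic, leadingCoeff_mul, leadingCoeff_C, inv_mul_cancel₀ hlc]
  · rw [natDegree_C_mul (inv_ne_zero hlc), hvdeg]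
  · have : Lop l b (C v.leadingCoeff⁻¹ * v) = C v.leadingCoeff⁻¹ * Lop l b v := by
      simp only [Lop, derivative_C_mul]; ring
    rw [this, hvL, mul_zero]
  · have key : ∀ w : Polynomial k, w.Monic ∧ w.natDegree = p - 1 ∧ Lop l b w = 0 →
        w = C v.leadingCoeff⁻¹ * v := by
      rintro w ⟨hw, hwd, hwL⟩
      have hL : Lop l b (w - C v.leadingCoeff⁻¹ * v) = 0 := by
        have : Lop l b (w - C v.leadingCoeff⁻¹ * v)
            = Lop l b w - C v.leadingCoeff⁻¹ * Lop l b v := by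
          simp only [Lop, derivative_sub, derivative_C_mul]; ring
        rw [this, hvL, hwL]; simp
      by_contra hne
      have hne' := sub_ne_zero.2 hne
      have hdle : (w - C v.leadingCoeff⁻¹ * v).natDegree ≤ p - 1 := by
        refine (natDegree_sub_le _ _).trans (max_le hwd.le ?_)
        exact (natDegree_C_mul_le _ _).trans hvdeg.le
      have hd := Lop_deg p hp l b _ hne' hL (by omega)
      apply hne'
      apply leadingCoeff_eq_zero.1
      rw [leadingCoeff, hd, coeff_sub, coeff_C_mul]
      have a1 : w.coeff (p - 1) = 1 := by rw [← hwd]; exact hw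
      have a2 : v.coeff (p - 1) = v.leadingCoeff := by rw [← hvdeg]; rfl
      rw [a1, a2, inv_mul_cancel₀ hlc, sub_self]
    exact key
end
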